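/- Let p ∈ (1,n), let Ω ⊂ ℝ^n be a bounded nonempty open set, let A : closure(Ω) → n×n real symmetric matrices be continuous and uniformly positive definite, and let G : ℝ^d → ℝ be continuous and positively homogeneous of degree p* = np/(n−p). If C₁, C₂ > 0 are constants such that (∫_Ω G(u(x)) dx)^{p/p*} ≤ C₁·‖u‖_{W_A}^p + C₂·‖u‖_{L^p(Ω;ℝ^d)}^p for every smooth compactly supported u : Ω → ℝ^d, then C₁ ≥ m_A^{−p/(2n)} · M_G^{p/p*} · S, where S is the classical sharp Sobolev constant. -/

import Mathlib

open Real MeasureTheory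

/-- The quadratic form `⟨M ξ, ξ⟩` of a matrix `M` on `ℝ^n`. -/
noncomputable def quadForm {n : ℕ} (M : Matrix (Fin n) (Fin n) ℝ)
    (ξ : EuclideanSpace ℝ (Fin n)) : ℝ :=
  ∑ i, ∑ j, M i j * ξ j * ξ i

/-- Smooth functions with compact support contained in `Ω`. -/
def SmoothCpt {n : ℕ} {E : Type*} [NormedAddCommGroup E] [NormedSpace ℝ E]
    (Ω : Set (EuclideanSpace ℝ (Fin n))) (u : EuclideanSpace ℝ (Fin n) → E) : Prop :=
  ContDiff ℝ (⊤ : ℕ∞) u ∧ HasCompactSupport u ∧ tsupport u ⊆ Ω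

/-- The anisotropic Sobolev energy `‖u‖_{W_A}^p` of a vector-valued function. -/
noncomputable def WAnorm {n d : ℕ} (p : ℝ) (Ω : Set (EuclideanSpace ℝ (Fin n)))
    (A : EuclideanSpace ℝ (Fin n) → Matrix (Fin n) (Fin n) ℝ)
    (u : EuclideanSpace ℝ (Fin n) → EuclideanSpace ℝ (Fin d)) : ℝ :=
  ∑ j, ∫ x in Ω, (quadForm (A x) (gradient (fun y => u y j) x)) ^ (p / 2)

/-- The classical sharp Sobolev constant `S = S(n,p)` on `ℝ^n`, defined via
`S⁻¹ = inf { ∫ |∇u|^p : ‖u‖_{p*} = 1 }`. -/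
noncomputable def classicalSobolev (n : ℕ) (p : ℝ) : ℝ :=
  (sInf {r : ℝ | ∃ u : EuclideanSpace ℝ (Fin n) → ℝ,
    ContDiff ℝ (⊤ : ℕ∞) u ∧ HasCompactSupport u ∧
    (∫ x, |u x| ^ ((n : ℝ) * p / ((n : ℝ) - p))) = 1 ∧
    r = ∫ x, ‖gradient u x‖ ^ p})⁻¹

lemma quadForm_eq_dot {n : ℕ} (M : Matrix (Fin n) (Fin n) ℝ) (ξ : EuclideanSpace ℝ (Fin n)) :
    quadForm M ξ = (WithLp.ofLp ξ) ⬝ᵥ (M.mulVec (WithLp.ofLp ξ)) := by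
  unfold quadForm
  simp only [dotProduct, Matrix.mulVec, Finset.mul_sum]
  exact Finset.sum_congr rfl fun i _ => Finset.sum_congr rfl fun j _ => by ring

open Matrix MatrixOrder in
lemma exists_sqrt_map {n : ℕ} (M : Matrix (Fin n) (Fin n) ℝ) (hM : M.PosDef) :
    ∃ T : EuclideanSpace ℝ (Fin n) ≃L[ℝ] EuclideanSpace ℝ (Fin n),
      (∀ ξ, quadForm M ξ =
        ‖ContinuousLinearMap.adjoint (T : EuclideanSpace ℝ (Fin n) →L[ℝ] _) ξ‖ ^ 2) ∧
      (LinearMap.det (T : EuclideanSpace ℝ (Fin n) →ₗ[ℝ] _)) ^ 2 = M.det := by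
  obtain ⟨C, hC⟩ := CStarAlgebra.nonneg_iff_eq_star_mul_self.mp hM.posSemidef.nonneg
  have hdet : M.det = C.det ^ 2 := by
    rw [hC, Matrix.det_mul, Matrix.star_eq_conjTranspose, Matrix.det_conjTranspose]; simp [sq]
  have hne : C.det ≠ 0 := by
    intro h; have := hM.det_pos; rw [hdet, h] at this; simp at this
  let L := Matrix.toEuclideanCLM (𝕜 := ℝ) (n := Fin n) (star C)
  have hLdet : LinearMap.det (L : EuclideanSpace ℝ (Fin n) →ₗ[ℝ] EuclideanSpace ℝ (Fin n))
      = C.det := by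
    have : (L : EuclideanSpace ℝ (Fin n) →ₗ[ℝ] EuclideanSpace ℝ (Fin n))
      = Matrix.toEuclideanLin (star C) := rfl
    rw [this, Matrix.toEuclideanLin_eq_toLin, LinearMap.det_toLin, Matrix.star_eq_conjTranspose,
      Matrix.det_conjTranspose]; simp
  have hLu : IsUnit (LinearMap.det (L : EuclideanSpace ℝ (Fin n) →ₗ[ℝ] EuclideanSpace ℝ (Fin n))) := by
    rw [hLdet]; exact hne.isUnit
  refine ⟨(L.toContinuousLinearEquivOfDetNeZero hLu.ne_zero), ?_, ?_⟩
  · intro ξ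
    have e1 : (((L.toContinuousLinearEquivOfDetNeZero hLu.ne_zero) :
      EuclideanSpace ℝ (Fin n) ≃L[ℝ] EuclideanSpace ℝ (Fin n)) :
       EuclideanSpace ℝ (Fin n) →L[ℝ] _) = L := by
      ext x; rfl
    rw [e1, ← ContinuousLinearMap.star_eq_adjoint, ← map_star, star_star, quadForm_eq_dot,
      EuclideanSpace.norm_sq_eq]
    simp only [Matrix.ofLp_toEuclideanCLM, Real.norm_eq_abs, sq_abs]
    rw [hC, ← Matrix.mulVec_mulVec, Matrix.dotProduct_mulVec, Matrix.star_eq_conjTranspose,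
      ← Matrix.mulVec_transpose]
    simp [dotProduct, sq, Matrix.conjTranspose_eq_transpose_of_trivial]
  · rw [hdet, ← hLdet]; rfl

lemma cov {n : ℕ} (T : EuclideanSpace ℝ (Fin n) ≃L[ℝ] EuclideanSpace ℝ (Fin n))
    (x0 : EuclideanSpace ℝ (Fin n)) (f : EuclideanSpace ℝ (Fin n) → ℝ) :
    ∫ x, f (T.symm (x - x0)) =
      |LinearMap.det (T : EuclideanSpace ℝ (Fin n) →ₗ[ℝ] EuclideanSpace ℝ (Fin n))| * ∫ x, f x := by
  rw [integral_sub_right_eq_self (fun x => f (T.symm x)) x0]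
  have h := integral_map_equiv (μ := volume) T.symm.toHomeomorph.toMeasurableEquiv f
  have h2 := Measure.map_linearMap_addHaar_eq_smul_addHaar (E := EuclideanSpace ℝ (Fin n))
    volume (f := T.symm.toLinearEquiv.toLinearMap) (LinearEquiv.isUnit_det' _).ne_zero
  have h3 : (LinearMap.det (T.symm.toLinearEquiv.toLinearMap))⁻¹ =
     LinearMap.det (T : EuclideanSpace ℝ (Fin n) →ₗ[ℝ] EuclideanSpace ℝ (Fin n)) := by
    have := LinearEquiv.det_symm_mul_det T.toLinearEquiv
    exact inv_eq_of_mul_eq_one_right this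
  rw [h3] at h2
  have h4 : (Measure.map (T.symm.toHomeomorph.toMeasurableEquiv) volume) = Measure.map (T.symm.toLinearEquiv.toLinearMap) (volume : Measure (EuclideanSpace ℝ (Fin n))) := rfl
  rw [h4, h2, integral_smul_measure, ENNReal.toReal_ofReal (abs_nonneg _)] at h
  exact h.symm

/-- the approximation of the absolute value -/
noncomputable def absApprox (δ t : ℝ) : ℝ := √(t ^ 2 + δ ^ 2) - δ

lemma absApprox_nonneg {δ : ℝ} (hδ : 0 < δ) (t : ℝ) : 0 ≤ absApprox δ t := by
  unfold absApprox
  have : δ ≤ √(t ^ 2 + δ ^ 2) := Real.le_sqrt_of_sq_le (by nlinarith [sq_nonneg t])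
  linarith

lemma absApprox_le {δ : ℝ} (hδ : 0 < δ) (t : ℝ) : absApprox δ t ≤ |t| := by
  unfold absApprox
  have : √(t ^ 2 + δ ^ 2) ≤ |t| + δ := by
    apply Real.sqrt_le_iff.mpr
    refine ⟨by positivity, ?_⟩
    nlinarith [sq_abs t, mul_nonneg (abs_nonneg t) hδ.le]
  linarith

lemma le_absApprox {δ : ℝ} (t : ℝ) : |t| - δ ≤ absApprox δ t := by
  unfold absApprox
  have : |t| ≤ √(t ^ 2 + δ ^ 2) := by
    apply Real.le_sqrt_of_sq_le; rw [sq_abs]; nlinarith [sq_nonneg δ]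
  linarith

lemma absApprox_zero {δ : ℝ} (hδ : 0 < δ) : absApprox δ 0 = 0 := by
  unfold absApprox
  simp [Real.sqrt_sq hδ.le]

lemma contDiff_absApprox {δ : ℝ} (hδ : 0 < δ) : ContDiff ℝ (⊤ : ℕ∞) (absApprox δ) := by
  unfold absApprox
  refine ContDiff.sub (ContDiff.sqrt (by fun_prop) fun t => by positivity) contDiff_const

lemma hasDerivAt_absApprox {δ : ℝ} (hδ : 0 < δ) (t : ℝ) :
    ∃ c, |c| ≤ 1 ∧ HasDerivAt (absApprox δ) c t := by
  have hpos : 0 < t ^ 2 + δ ^ 2 := by positivity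
  have h : HasDerivAt (fun t : ℝ => t ^ 2 + δ ^ 2) (2 * t) t := by
    simpa using (hasDerivAt_pow 2 t).add_const (δ ^ 2)
  refine ⟨_, ?_, (h.sqrt hpos.ne').sub_const δ⟩
  rw [abs_div, div_le_one (by positivity), abs_mul, abs_mul, abs_of_nonneg (Real.sqrt_nonneg _)]
  have : |t| ≤ √(t ^ 2 + δ ^ 2) := by
    apply Real.le_sqrt_of_sq_le; rw [sq_abs]; nlinarith [sq_nonneg δ]
  gcongr

lemma norm_gradient_eq {n : ℕ} (u : EuclideanSpace ℝ (Fin n) → ℝ) (x : EuclideanSpace ℝ (Fin n)) :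
    ‖gradient u x‖ = ‖fderiv ℝ u x‖ := by
  unfold gradient; simp

lemma norm_gradient_absApprox_le {n : ℕ} {δ : ℝ} (hδ : 0 < δ) (u : EuclideanSpace ℝ (Fin n) → ℝ)
    (hu : ContDiff ℝ (⊤ : ℕ∞) u) (x : EuclideanSpace ℝ (Fin n)) :
    ‖gradient (absApprox δ ∘ u) x‖ ≤ ‖gradient u x‖ := by
  rw [norm_gradient_eq, norm_gradient_eq]
  obtain ⟨c, hc, h⟩ := hasDerivAt_absApprox hδ (u x)
  have hd : DifferentiableAt ℝ u x := (hu.differentiable (by simp)) x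
  rw [(h.comp_hasFDerivAt x hd.hasFDerivAt).fderiv, norm_smul]
  exact mul_le_of_le_one_left (norm_nonneg _) hc

lemma integrable_gradient_rpow {n : ℕ} {p : ℝ} (hp : 0 < p) (u : EuclideanSpace ℝ (Fin n) → ℝ)
    (hu : ContDiff ℝ (⊤ : ℕ∞) u) (hc : HasCompactSupport u) :
    Integrable (fun x => ‖gradient u x‖ ^ p) := by
  simp_rw [norm_gradient_eq]
  refine Continuous.integrable_of_hasCompactSupport ?_ ?_
  · exact ((hu.continuous_fderiv (by simp)).norm).rpow_const fun _ => Or.inr hp.le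
  · exact (hc.fderiv ℝ).comp_left (g := fun L => ‖L‖ ^ p) (by simp [hp.ne'])

lemma integrable_abs_rpow {n : ℕ} {p : ℝ} (hp : 0 < p) (u : EuclideanSpace ℝ (Fin n) → ℝ)
    (hu : ContDiff ℝ (⊤ : ℕ∞) u) (hc : HasCompactSupport u) :
    Integrable (fun x => |u x| ^ p) := by
  refine Continuous.integrable_of_hasCompactSupport ?_ ?_
  · exact (hu.continuous.abs).rpow_const fun _ => Or.inr hp.le
  · exact hc.comp_left (g := fun L => |L| ^ p) (by simp [hp.ne'])

lemma integrable_comp_affine {n : ℕ} (T : EuclideanSpace ℝ (Fin n) ≃L[ℝ] EuclideanSpace ℝ (Fin n))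
    (x0 : EuclideanSpace ℝ (Fin n)) (f : EuclideanSpace ℝ (Fin n) → ℝ) (hf : Continuous f)
    (hc : HasCompactSupport f) : Integrable (fun x => f (T.symm (x - x0))) := by
  refine Continuous.integrable_of_hasCompactSupport (by fun_prop) ?_
  exact hc.comp_homeomorph ((Homeomorph.subRight x0).trans T.symm.toHomeomorph)

lemma adjoint_gradient {n : ℕ} (T : EuclideanSpace ℝ (Fin n) ≃L[ℝ] EuclideanSpace ℝ (Fin n))
    (x0 : EuclideanSpace ℝ (Fin n)) (w : EuclideanSpace ℝ (Fin n) → ℝ)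
    (hw : ContDiff ℝ (⊤ : ℕ∞) w) (x : EuclideanSpace ℝ (Fin n)) :
    ContinuousLinearMap.adjoint (T : EuclideanSpace ℝ (Fin n) →L[ℝ] EuclideanSpace ℝ (Fin n))
      (gradient (fun x => w (T.symm (x - x0))) x) = gradient w (T.symm (x - x0)) := by
  refine ext_inner_right ℝ fun z => ?_
  rw [ContinuousLinearMap.adjoint_inner_left]
  unfold gradient
  rw [InnerProductSpace.toDual_symm_apply, InnerProductSpace.toDual_symm_apply]
  have h1 : HasFDerivAt w (fderiv ℝ w (T.symm (x - x0))) (T.symm (x - x0)) :=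
    (hw.differentiable (by simp) _).hasFDerivAt
  have h2 : HasFDerivAt (fun x => T.symm (x - x0))
      (T.symm : EuclideanSpace ℝ (Fin n) →L[ℝ] EuclideanSpace ℝ (Fin n)) x :=
    T.symm.hasFDerivAt.comp x ((hasFDerivAt_id x).sub_const x0)
  have h3 := (h1.comp x h2).fderiv
  have h4 : (fun x => w (T.symm (x - x0))) = w ∘ (fun x => T.symm (x - x0)) := rfl
  rw [h4, h3]
  simp

lemma quadForm_smul {n : ℕ} (M : Matrix (Fin n) (Fin n) ℝ) (c : ℝ)
    (ξ : EuclideanSpace ℝ (Fin n)) : quadForm M (c • ξ) = c ^ 2 * quadForm M ξ := by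
  unfold quadForm
  simp only [Finset.mul_sum, PiLp.smul_apply, smul_eq_mul]
  exact Finset.sum_congr rfl fun i _ => Finset.sum_congr rfl fun j _ => by ring

lemma gradient_mul_const' {n : ℕ} (v : EuclideanSpace ℝ (Fin n) → ℝ) (c : ℝ)
    (hv : ContDiff ℝ (⊤ : ℕ∞) v) (x : EuclideanSpace ℝ (Fin n)) :
    gradient (fun y => v y * c) x = c • gradient v x := by
  unfold gradient
  rw [fderiv_mul_const (hv.differentiable (by simp) x)]
  simp

lemma step2 {n d : ℕ} (p q a : ℝ) (hp : 0 < p) (hq : 0 < q)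
    (Ω : Set (EuclideanSpace ℝ (Fin n))) (hΩo : IsOpen Ω)
    (A : EuclideanSpace ℝ (Fin n) → Matrix (Fin n) (Fin n) ℝ)
    (G : EuclideanSpace ℝ (Fin d) → ℝ)
    (hGhom : ∀ ϱ : ℝ, 0 < ϱ → ∀ s : EuclideanSpace ℝ (Fin d), G (ϱ • s) = ϱ ^ q * G s)
    (C₁ C₂ : ℝ) (hC₁ : 0 < C₁) (hC₂ : 0 < C₂)
    (hineq : ∀ u : EuclideanSpace ℝ (Fin n) → EuclideanSpace ℝ (Fin d), SmoothCpt Ω u →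
      (∫ x in Ω, G (u x)) ^ a
        ≤ C₁ * WAnorm p Ω A u + C₂ * ∑ j, ∫ x in Ω, |u x j| ^ p)
    (s : EuclideanSpace ℝ (Fin d)) (hs : (∑ i, |s i| ^ p) = 1)
    (x0 : EuclideanSpace ℝ (Fin n))
    (T : EuclideanSpace ℝ (Fin n) ≃L[ℝ] EuclideanSpace ℝ (Fin n))
    (hT : ∀ ξ, quadForm (A x0) ξ =
        ‖ContinuousLinearMap.adjoint (T : EuclideanSpace ℝ (Fin n) →L[ℝ] _) ξ‖ ^ 2)
    (w : EuclideanSpace ℝ (Fin n) → ℝ) (hw : ContDiff ℝ (⊤ : ℕ∞) w) (hwc : HasCompactSupport w)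
    (hw0 : ∀ x, 0 ≤ w x) (r θ : ℝ) (hθ : 0 ≤ θ)
    (hball : Metric.closedBall x0 r ⊆ Ω)
    (hsupp : ∀ x, w (T.symm (x - x0)) ≠ 0 → x ∈ Metric.closedBall x0 r)
    (hA : ∀ x ∈ Metric.closedBall x0 r, ∀ ξ, 0 ≤ quadForm (A x) ξ ∧
      quadForm (A x) ξ ≤ θ * quadForm (A x0) ξ) :
    (|LinearMap.det (T : EuclideanSpace ℝ (Fin n) →ₗ[ℝ] EuclideanSpace ℝ (Fin n))|
        * ((∫ x, |w x| ^ q) * G s)) ^ a ≤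
      C₁ * (θ ^ (p / 2) *
        (|LinearMap.det (T : EuclideanSpace ℝ (Fin n) →ₗ[ℝ] EuclideanSpace ℝ (Fin n))|
          * ∫ x, ‖gradient w x‖ ^ p)) +
      C₂ * (|LinearMap.det (T : EuclideanSpace ℝ (Fin n) →ₗ[ℝ] EuclideanSpace ℝ (Fin n))|
          * ∫ x, |w x| ^ p) := by
  set v : EuclideanSpace ℝ (Fin n) → ℝ := fun x => w (T.symm (x - x0)) with hvdef
  have hv : ContDiff ℝ (⊤ : ℕ∞) v := by
    apply hw.comp
    fun_prop
  have htv : tsupport v ⊆ Metric.closedBall x0 r :=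
    closure_minimal (fun x hx => hsupp x hx) Metric.isClosed_closedBall
  have hvc : HasCompactSupport v := HasCompactSupport.of_support_subset_isCompact
    (isCompact_closedBall x0 r) (fun x hx => hsupp x hx)
  have hG0 : G 0 = 0 := by
    have h := hGhom 2 (by norm_num) 0
    rw [smul_zero] at h
    have h2 : (1 : ℝ) < 2 ^ q := Real.one_lt_rpow (by norm_num) hq
    have : (2 ^ q - 1) * G 0 = 0 := by linarith
    rcases mul_eq_zero.mp this with h' | h'
    · linarith
    · exact h'
  have hGt : ∀ t : ℝ, 0 ≤ t → G (t • s) = |t| ^ q * G s := by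
    intro t ht
    rcases ht.eq_or_lt with h | h
    · rw [← h]; simp [hG0, hq.ne']
    · rw [hGhom t h, abs_of_pos h]
  have hvout : ∀ x, x ∉ Ω → v x = 0 := by
    intro x hx
    by_contra h
    exact hx (hball (hsupp x h))
  have hsm : SmoothCpt Ω (fun x => v x • s) := by
    have hsub : Function.support (fun x => v x • s) ⊆ Metric.closedBall x0 r := by
      intro x hx
      apply hsupp
      intro h
      apply hx
      change v x • s = 0
      rw [show v x = 0 from h, zero_smul]
    refine ⟨hv.smul contDiff_const, HasCompactSupport.of_support_subset_isCompact
      (isCompact_closedBall x0 r) hsub, ?_⟩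
    exact (closure_minimal hsub Metric.isClosed_closedBall).trans hball
  have key := hineq _ hsm
  have e1 : ∫ x in Ω, G (v x • s) =
      |LinearMap.det (T : EuclideanSpace ℝ (Fin n) →ₗ[ℝ] EuclideanSpace ℝ (Fin n))|
        * ((∫ x, |w x| ^ q) * G s) := by
    rw [setIntegral_eq_integral_of_forall_compl_eq_zero (fun x hx => by rw [hvout x hx]; simp [hG0])]
    rw [← integral_mul_const, ← cov T x0 (fun x => |w x| ^ q * G s)]
    exact integral_congr_ae (Filter.Eventually.of_forall fun x => hGt _ (hw0 _))
  have e2 : WAnorm p Ω A (fun x => v x • s) ≤ θ ^ (p / 2) *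
        (|LinearMap.det (T : EuclideanSpace ℝ (Fin n) →ₗ[ℝ] EuclideanSpace ℝ (Fin n))|
          * ∫ x, ‖gradient w x‖ ^ p) := by
    rw [← cov T x0 (fun x => ‖gradient w x‖ ^ p)]
    have hint : Integrable (fun x => ‖gradient w (T.symm (x - x0))‖ ^ p) := by
      refine integrable_comp_affine T x0 (fun x => ‖gradient w x‖ ^ p) ?_ ?_
      · simp_rw [norm_gradient_eq]
        exact ((hw.continuous_fderiv (by simp)).norm).rpow_const fun _ => Or.inr hp.le
      · simp_rw [norm_gradient_eq]
        exact (hwc.fderiv ℝ).comp_left (g := fun L => ‖L‖ ^ p) (by simp [hp.ne'])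
    have hj : ∀ j, ∫ x in Ω, (quadForm (A x) (gradient (fun y => (v y • s) j) x)) ^ (p / 2) ≤
        |s j| ^ p * (θ ^ (p / 2) * ∫ x, ‖gradient w (T.symm (x - x0))‖ ^ p) := by
      intro j
      have hpt : ∀ x, 0 ≤ (quadForm (A x) (gradient (fun y => (v y • s) j) x)) ^ (p / 2) ∧
          (quadForm (A x) (gradient (fun y => (v y • s) j) x)) ^ (p / 2) ≤
          |s j| ^ p * (θ ^ (p / 2) * ‖gradient w (T.symm (x - x0))‖ ^ p) := by
        intro x
        have hg : gradient (fun y => (v y • s) j) x = s j • gradient v x :=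
          gradient_mul_const' v (s j) hv x
        rw [hg, quadForm_smul]
        by_cases hx : x ∈ Metric.closedBall x0 r
        · obtain ⟨h0, h1⟩ := hA x hx (gradient v x)
          refine ⟨by positivity, ?_⟩
          rw [hT, adjoint_gradient T x0 w hw x] at h1
          rw [Real.mul_rpow (sq_nonneg _) h0]
          have k1 : (s j ^ 2) ^ (p / 2) = |s j| ^ p := by
            rw [← sq_abs, ← Real.rpow_natCast, ← Real.rpow_mul (abs_nonneg _)]
            congr 1; push_cast; ring
          have k2 : (‖gradient w (T.symm (x - x0))‖ ^ 2) ^ (p / 2)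
              = ‖gradient w (T.symm (x - x0))‖ ^ p := by
            rw [← Real.rpow_natCast, ← Real.rpow_mul (norm_nonneg _)]
            congr 1; push_cast; ring
          rw [k1, ← k2, ← Real.mul_rpow hθ (sq_nonneg _)]
          gcongr
        · have hz : gradient v x = 0 := by
            have : fderiv ℝ v x = 0 := by
              by_contra h
              exact hx (htv (support_fderiv_subset ℝ h))
            unfold gradient; rw [this]; simp
          have hq0 : quadForm (A x) (0 : EuclideanSpace ℝ (Fin n)) = 0 := by simp [quadForm]
          rw [hz, hq0, mul_zero, Real.zero_rpow (by positivity)]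
          exact ⟨le_rfl, by positivity⟩
      have hint2 := (hint.const_mul (θ ^ (p / 2))).const_mul (|s j| ^ p)
      rw [← integral_const_mul, ← integral_const_mul]
      refine le_trans (integral_mono_of_nonneg (Filter.Eventually.of_forall fun x => (hpt x).1)
        hint2.integrableOn (Filter.Eventually.of_forall fun x => (hpt x).2)) ?_
      exact setIntegral_le_integral hint2
        (Filter.Eventually.of_forall fun x => (hpt x).1.trans (hpt x).2)
    unfold WAnorm
    refine (Finset.sum_le_sum fun j _ => hj j).trans ?_
    rw [← Finset.sum_mul, hs, one_mul]
  have e3 : ∑ j, ∫ x in Ω, |(v x • s) j| ^ p ≤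
      |LinearMap.det (T : EuclideanSpace ℝ (Fin n) →ₗ[ℝ] EuclideanSpace ℝ (Fin n))|
          * ∫ x, |w x| ^ p := by
    rw [← cov T x0 (fun x => |w x| ^ p)]
    have hint : Integrable (fun x => |v x| ^ p) := integrable_abs_rpow hp v hv hvc
    have hj : ∀ j, ∫ x in Ω, |(v x • s) j| ^ p ≤ |s j| ^ p * ∫ x, |v x| ^ p := by
      intro j
      have hpt : ∀ x, |(v x • s) j| ^ p = |s j| ^ p * |v x| ^ p := by
        intro x
        rw [PiLp.smul_apply, smul_eq_mul, abs_mul, Real.mul_rpow (abs_nonneg _) (abs_nonneg _),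
          mul_comm]
      simp_rw [hpt]
      rw [← integral_const_mul]
      exact setIntegral_le_integral (hint.const_mul _)
        (Filter.Eventually.of_forall fun x => by positivity)
    refine (Finset.sum_le_sum fun j _ => hj j).trans ?_
    rw [← Finset.sum_mul, hs, one_mul]
  rw [e1] at key
  refine key.trans ?_
  gcongr

lemma gradient_scale {n : ℕ} (w : EuclideanSpace ℝ (Fin n) → ℝ)
    (hw : ContDiff ℝ (⊤ : ℕ∞) w) (c : ℝ) (x : EuclideanSpace ℝ (Fin n)) :
    gradient (fun x => w (c • x)) x = c • gradient w (c • x) := by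
  unfold gradient
  have h1 : HasFDerivAt w (fderiv ℝ w (c • x)) (c • x) :=
    (hw.differentiable (by simp) _).hasFDerivAt
  have h2 : HasFDerivAt (fun x : EuclideanSpace ℝ (Fin n) => c • x)
      (c • ContinuousLinearMap.id ℝ (EuclideanSpace ℝ (Fin n))) x :=
    (hasFDerivAt_id x).const_smul c
  have h3 := (h1.comp x h2).fderiv
  have h4 : (fun x => w (c • x)) = w ∘ (fun x => c • x) := rfl
  rw [h4, h3]
  simp

lemma quadForm_near {n : ℕ} (M N : Matrix (Fin n) (Fin n) ℝ) (κ : ℝ)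
    (h : ∑ i, ∑ j, |M i j - N i j| ≤ κ) (ξ : EuclideanSpace ℝ (Fin n)) :
    quadForm M ξ ≤ quadForm N ξ + κ * ‖ξ‖ ^ 2 := by
  have h1 : quadForm M ξ - quadForm N ξ ≤ (∑ i, ∑ j, |M i j - N i j|) * ‖ξ‖ ^ 2 := by
    unfold quadForm
    rw [← Finset.sum_sub_distrib, Finset.sum_mul]
    refine Finset.sum_le_sum fun i _ => ?_
    rw [← Finset.sum_sub_distrib, Finset.sum_mul]
    refine Finset.sum_le_sum fun j _ => ?_
    have hi : |ξ i| ≤ ‖ξ‖ := by simpa using PiLp.norm_apply_le ξ i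
    have hj : |ξ j| ≤ ‖ξ‖ := by simpa using PiLp.norm_apply_le ξ j
    calc M i j * ξ j * ξ i - N i j * ξ j * ξ i = (M i j - N i j) * (ξ j * ξ i) := by ring
      _ ≤ |(M i j - N i j) * (ξ j * ξ i)| := le_abs_self _
      _ = |M i j - N i j| * (|ξ j| * |ξ i|) := by rw [abs_mul, abs_mul]
      _ ≤ |M i j - N i j| * (‖ξ‖ * ‖ξ‖) := by gcongr
      _ = _ := by ring
  have : (∑ i, ∑ j, |M i j - N i j|) * ‖ξ‖ ^ 2 ≤ κ * ‖ξ‖ ^ 2 := by gcongr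
  linarith

open Filter Topology in
lemma step3 {n d : ℕ} (p q a : ℝ) (hp : 0 < p) (hq : 0 < q) (han : n * a = n - p)
    (Ω : Set (EuclideanSpace ℝ (Fin n))) (hΩo : IsOpen Ω)
    (A : EuclideanSpace ℝ (Fin n) → Matrix (Fin n) (Fin n) ℝ)
    (hAc : ContinuousOn A Ω) (τ : ℝ) (hτ : 0 < τ)
    (hApos : ∀ x ∈ Ω, ∀ ξ : EuclideanSpace ℝ (Fin n), τ * ‖ξ‖ ^ 2 ≤ quadForm (A x) ξ)
    (G : EuclideanSpace ℝ (Fin d) → ℝ)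
    (hGhom : ∀ ϱ : ℝ, 0 < ϱ → ∀ s : EuclideanSpace ℝ (Fin d), G (ϱ • s) = ϱ ^ q * G s)
    (C₁ C₂ : ℝ) (hC₁ : 0 < C₁) (hC₂ : 0 < C₂)
    (hineq : ∀ u : EuclideanSpace ℝ (Fin n) → EuclideanSpace ℝ (Fin d), SmoothCpt Ω u →
      (∫ x in Ω, G (u x)) ^ a
        ≤ C₁ * WAnorm p Ω A u + C₂ * ∑ j, ∫ x in Ω, |u x j| ^ p)
    (s : EuclideanSpace ℝ (Fin d)) (hs : (∑ i, |s i| ^ p) = 1) (hGs : 0 ≤ G s)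
    (x0 : EuclideanSpace ℝ (Fin n)) (hx0 : x0 ∈ Ω)
    (T : EuclideanSpace ℝ (Fin n) ≃L[ℝ] EuclideanSpace ℝ (Fin n))
    (hT : ∀ ξ, quadForm (A x0) ξ =
        ‖ContinuousLinearMap.adjoint (T : EuclideanSpace ℝ (Fin n) →L[ℝ] _) ξ‖ ^ 2)
    (w : EuclideanSpace ℝ (Fin n) → ℝ) (hw : ContDiff ℝ (⊤ : ℕ∞) w) (hwc : HasCompactSupport w)
    (hw0 : ∀ x, 0 ≤ w x) :
    (|LinearMap.det (T : EuclideanSpace ℝ (Fin n) →ₗ[ℝ] EuclideanSpace ℝ (Fin n))|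
        * ((∫ x, |w x| ^ q) * G s)) ^ a ≤
      C₁ * (|LinearMap.det (T : EuclideanSpace ℝ (Fin n) →ₗ[ℝ] EuclideanSpace ℝ (Fin n))|
          * ∫ x, ‖gradient w x‖ ^ p) := by
  set t := |LinearMap.det (T : EuclideanSpace ℝ (Fin n) →ₗ[ℝ] EuclideanSpace ℝ (Fin n))| with ht
  set X := ∫ x, |w x| ^ q with hX
  set Y := ∫ x, ‖gradient w x‖ ^ p with hY
  set Z := ∫ x, |w x| ^ p with hZ
  have hX0 : 0 ≤ X := integral_nonneg fun x => by positivity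
  have ht0 : 0 ≤ t := abs_nonneg _
  -- the inequality for each θ
  have hθ : ∀ θ : ℝ, 1 < θ → (t * (X * G s)) ^ a ≤ C₁ * (θ ^ (p / 2) * (t * Y)) := by
    intro θ hθ1
    -- radius
    have hcont : ContinuousAt (fun x => ∑ i, ∑ j, |A x i j - A x0 i j|) x0 := by
      have hA0 : ContinuousAt A x0 := hAc.continuousAt (hΩo.mem_nhds hx0)
      refine tendsto_finsetSum _ fun i _ => tendsto_finsetSum _ fun j _ => ?_
      have : ContinuousAt (fun x => A x i j) x0 := by
        exact (continuous_apply_apply i j).continuousAt.comp hA0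
      exact (this.sub continuousAt_const).abs
    have hev : ∀ᶠ x in 𝓝 x0, (∑ i, ∑ j, |A x i j - A x0 i j|) < (θ - 1) * τ ∧ x ∈ Ω := by
      refine (hcont.eventually_lt continuousAt_const ?_).and (hΩo.mem_nhds hx0)
      simp only [sub_self, abs_zero, Finset.sum_const_zero]
      exact mul_pos (by linarith) hτ
    obtain ⟨r, hr, hball⟩ := Metric.nhds_basis_closedBall.eventually_iff.mp hev
    obtain ⟨ρ, hρ⟩ := hwc.isCompact.isBounded.subset_closedBall (0 : EuclideanSpace ℝ (Fin n))
    have hsmall : ∀ᶠ ε : ℝ in 𝓝[>] 0, ‖(T : EuclideanSpace ℝ (Fin n) →L[ℝ]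
        EuclideanSpace ℝ (Fin n))‖ * (ε * ρ) < r := by
      refine Filter.Eventually.filter_mono nhdsWithin_le_nhds ?_
      have : ContinuousAt (fun ε : ℝ => ‖(T : EuclideanSpace ℝ (Fin n) →L[ℝ]
        EuclideanSpace ℝ (Fin n))‖ * (ε * ρ)) 0 := by fun_prop
      exact this.eventually_lt continuousAt_const (by simpa using hr)
    have hev2 : ∀ᶠ ε : ℝ in 𝓝[>] 0, (t * (X * G s)) ^ a ≤
        C₁ * (θ ^ (p / 2) * (t * Y)) + C₂ * (t * (ε ^ p * Z)) := by
      filter_upwards [hsmall, self_mem_nhdsWithin] with ε hε hε0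
      have hε0 : 0 < ε := hε0
      have hstep := step2 p q a hp hq Ω hΩo A G hGhom C₁ C₂ hC₁ hC₂ hineq s hs x0 T hT
        (fun x => w (ε⁻¹ • x)) (hw.comp (by fun_prop))
        (hwc.comp_homeomorph (Homeomorph.smulOfNeZero ε⁻¹ (inv_ne_zero hε0.ne')))
        (fun x => hw0 _) r θ (by linarith) (fun x hx => (hball hx).2) (by
          intro x hx
          have h1 : ε⁻¹ • T.symm (x - x0) ∈ Metric.closedBall 0 ρ := hρ (subset_closure hx)
          rw [mem_closedBall_zero_iff, norm_smul, norm_inv, Real.norm_eq_abs, abs_of_pos hε0,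
            inv_mul_le_iff₀ hε0] at h1
          rw [mem_closedBall_iff_norm]
          have h2 : x - x0 = (T : EuclideanSpace ℝ (Fin n) →L[ℝ]
            EuclideanSpace ℝ (Fin n)) (T.symm (x - x0)) := by simp
          rw [h2]
          refine (ContinuousLinearMap.le_opNorm _ _).trans (le_trans ?_ hε.le)
          gcongr) (by
          intro x hx ξ
          obtain ⟨h1, h2⟩ := hball hx
          have h3 := hApos x h2 ξ
          have h4 := hApos x0 hx0 ξ
          refine ⟨le_trans (by positivity) h3, ?_⟩
          have h5 := quadForm_near _ _ _ h1.le ξ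
          nlinarith)
      have i1 : ∫ x, |w (ε⁻¹ • x)| ^ q = ε ^ n * X := by
        rw [Measure.integral_comp_inv_smul_of_nonneg volume (fun x => |w x| ^ q) hε0.le]
        simp [hX]
      have i2 : ∫ x, |w (ε⁻¹ • x)| ^ p = ε ^ n * Z := by
        rw [Measure.integral_comp_inv_smul_of_nonneg volume (fun x => |w x| ^ p) hε0.le]
        simp [hZ]
      have i3 : ∫ x, ‖gradient (fun x => w (ε⁻¹ • x)) x‖ ^ p = ε ^ n * ((ε ^ p)⁻¹ * Y) := by
        simp_rw [gradient_scale w hw, norm_smul]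
        rw [Measure.integral_comp_inv_smul_of_nonneg volume
          (fun x => (‖ε⁻¹‖ * ‖gradient w x‖) ^ p) hε0.le]
        simp_rw [Real.mul_rpow (norm_nonneg _) (norm_nonneg _)]
        rw [integral_const_mul, norm_inv, Real.norm_eq_abs, abs_of_pos hε0, Real.inv_rpow hε0.le]
        simp [hY]
      rw [i1, i2, i3] at hstep
      have l1 : t * (ε ^ n * X * G s) = ε ^ n * (t * (X * G s)) := by ring
      have l2 : ((ε ^ n : ℝ)) ^ a = ε ^ n * (ε ^ p)⁻¹ := by
        rw [← Real.rpow_natCast, ← Real.rpow_mul hε0.le, han, Real.rpow_sub hε0, div_eq_mul_inv]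
      rw [l1, Real.mul_rpow (by positivity) (by positivity), l2] at hstep
      have hk : 0 < ε ^ n * (ε ^ p)⁻¹ := by positivity
      refine le_of_mul_le_mul_left (hstep.trans (le_of_eq ?_)) hk
      have : ε ^ p ≠ 0 := by positivity
      rw [← ht]
      field_simp
    have hlim : Tendsto (fun ε : ℝ => C₁ * (θ ^ (p / 2) * (t * Y)) + C₂ * (t * (ε ^ p * Z)))
        (𝓝[>] 0) (𝓝 (C₁ * (θ ^ (p / 2) * (t * Y)) + C₂ * (t * ((0 : ℝ) ^ p * Z)))) := by
      have h1 : Tendsto (fun ε : ℝ => ε ^ p) (𝓝[>] 0) (𝓝 ((0 : ℝ) ^ p)) :=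
        ((Real.continuousAt_rpow_const 0 p (Or.inr hp.le)).tendsto).mono_left nhdsWithin_le_nhds
      exact tendsto_const_nhds.add (((h1.mul_const Z).const_mul t).const_mul C₂)
    have := ge_of_tendsto hlim hev2
    rwa [Real.zero_rpow hp.ne', zero_mul, mul_zero, mul_zero, add_zero] at this
  have hlim : Tendsto (fun θ : ℝ => C₁ * (θ ^ (p / 2) * (t * Y))) (𝓝[>] 1)
      (𝓝 (C₁ * ((1 : ℝ) ^ (p / 2) * (t * Y)))) := by
    have h1 : Tendsto (fun θ : ℝ => θ ^ (p / 2)) (𝓝[>] 1) (𝓝 ((1 : ℝ) ^ (p / 2))) :=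
      ((Real.continuousAt_rpow_const 1 _ (Or.inl one_ne_zero)).tendsto).mono_left
        nhdsWithin_le_nhds
    exact (h1.mul_const _).const_mul _
  have := ge_of_tendsto hlim (Filter.mem_of_superset self_mem_nhdsWithin hθ)
  rwa [Real.one_rpow, one_mul] at this

open Filter Topology in
lemma step4 {n d : ℕ} (p q a : ℝ) (hp : 0 < p) (hq : 0 < q) (ha : 0 < a) (hn0 : (0 : ℝ) < n)
    (han : n * a = n - p)
    (Ω : Set (EuclideanSpace ℝ (Fin n))) (hΩo : IsOpen Ω)
    (A : EuclideanSpace ℝ (Fin n) → Matrix (Fin n) (Fin n) ℝ)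
    (hAc : ContinuousOn A Ω) (τ : ℝ) (hτ : 0 < τ)
    (hApos : ∀ x ∈ Ω, ∀ ξ : EuclideanSpace ℝ (Fin n), τ * ‖ξ‖ ^ 2 ≤ quadForm (A x) ξ)
    (G : EuclideanSpace ℝ (Fin d) → ℝ)
    (hGhom : ∀ ϱ : ℝ, 0 < ϱ → ∀ s : EuclideanSpace ℝ (Fin d), G (ϱ • s) = ϱ ^ q * G s)
    (C₁ C₂ : ℝ) (hC₁ : 0 < C₁) (hC₂ : 0 < C₂)
    (hineq : ∀ u : EuclideanSpace ℝ (Fin n) → EuclideanSpace ℝ (Fin d), SmoothCpt Ω u →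
      (∫ x in Ω, G (u x)) ^ a
        ≤ C₁ * WAnorm p Ω A u + C₂ * ∑ j, ∫ x in Ω, |u x j| ^ p)
    (s : EuclideanSpace ℝ (Fin d)) (hs : (∑ i, |s i| ^ p) = 1) (hGs : 0 < G s)
    (x0 : EuclideanSpace ℝ (Fin n)) (hx0 : x0 ∈ Ω) (hPD : (A x0).PosDef)
    (u : EuclideanSpace ℝ (Fin n) → ℝ) (hu : ContDiff ℝ (⊤ : ℕ∞) u) (huc : HasCompactSupport u)
    (hu1 : (∫ x, |u x| ^ q) = 1) :
    (A x0).det ^ (-(p / (2 * (n : ℝ)))) * G s ^ a ≤ C₁ * ∫ x, ‖gradient u x‖ ^ p := by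
  obtain ⟨T, hT, hTdet⟩ := exists_sqrt_map (A x0) hPD
  set t := |LinearMap.det (T : EuclideanSpace ℝ (Fin n) →ₗ[ℝ] EuclideanSpace ℝ (Fin n))| with ht
  have htD : t ^ 2 = (A x0).det := by rw [ht, sq_abs, hTdet]
  have htpos : 0 < t := by
    refine (abs_nonneg _).lt_of_ne' fun h => ?_
    have := hPD.det_pos
    rw [← htD, ht, h] at this
    simp at this
  have hδ : ∀ δ : ℝ, 0 < δ → (t * ((∫ x, |absApprox δ (u x)| ^ q) * G s)) ^ a ≤
      C₁ * (t * ∫ x, ‖gradient u x‖ ^ p) := by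
    intro δ hδ
    have h := step3 p q a hp hq han Ω hΩo A hAc τ hτ hApos G hGhom C₁ C₂ hC₁ hC₂ hineq s hs
      hGs.le x0 hx0 T hT (absApprox δ ∘ u) ((contDiff_absApprox hδ).comp hu)
      (huc.comp_left (absApprox_zero hδ)) (fun x => absApprox_nonneg hδ _)
    refine h.trans ?_
    have hI : ∫ x, ‖gradient (absApprox δ ∘ u) x‖ ^ p ≤ ∫ x, ‖gradient u x‖ ^ p := by
      refine integral_mono_of_nonneg (Eventually.of_forall fun x => by positivity)
        (integrable_gradient_rpow hp u hu huc) (Eventually.of_forall fun x => ?_)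
      exact Real.rpow_le_rpow (norm_nonneg _) (norm_gradient_absApprox_le hδ u hu x) hp.le
    gcongr
  have hX : Tendsto (fun δ : ℝ => ∫ x, |absApprox δ (u x)| ^ q) (𝓝[>] 0) (𝓝 1) := by
    rw [← hu1]
    refine tendsto_integral_filter_of_dominated_convergence (fun x => |u x| ^ q) ?_ ?_
      (integrable_abs_rpow hq u hu huc) ?_
    · filter_upwards [self_mem_nhdsWithin] with δ hδ
      have : Continuous fun x => |absApprox δ (u x)| ^ q :=
        (((contDiff_absApprox hδ).continuous.comp hu.continuous).abs).rpow_const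
          fun _ => Or.inr hq.le
      exact this.aestronglyMeasurable
    · filter_upwards [self_mem_nhdsWithin] with δ hδ
      refine Eventually.of_forall fun x => ?_
      rw [Real.norm_eq_abs, abs_of_nonneg (by positivity), abs_of_nonneg (absApprox_nonneg hδ _)]
      exact Real.rpow_le_rpow (absApprox_nonneg hδ _) (absApprox_le hδ _) hq.le
    · refine Eventually.of_forall fun x => ?_
      have h1 : Tendsto (fun δ : ℝ => absApprox δ (u x)) (𝓝[>] 0) (𝓝 |u x|) := by
        have h2 : Tendsto (fun δ : ℝ => |u x| - δ) (𝓝[>] 0) (𝓝 |u x|) := by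
          have : Tendsto (fun δ : ℝ => |u x| - δ) (𝓝 0) (𝓝 (|u x| - 0)) :=
            tendsto_const_nhds.sub tendsto_id
          rw [sub_zero] at this
          exact this.mono_left nhdsWithin_le_nhds
        refine tendsto_of_tendsto_of_tendsto_of_le_of_le' h2 tendsto_const_nhds
          (Eventually.of_forall fun δ => le_absApprox _) ?_
        filter_upwards [self_mem_nhdsWithin] with δ hδ using absApprox_le hδ _
      have h3 := h1.abs
      rw [abs_abs] at h3
      exact h3.rpow_const (Or.inr hq.le)
  have hlim : Tendsto (fun δ : ℝ => (t * ((∫ x, |absApprox δ (u x)| ^ q) * G s)) ^ a) (𝓝[>] 0)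
      (𝓝 ((t * (1 * G s)) ^ a)) :=
    ((hX.mul_const _).const_mul t).rpow_const (Or.inr ha.le)
  have hfin := le_of_tendsto hlim (Filter.mem_of_superset self_mem_nhdsWithin hδ)
  rw [one_mul, Real.mul_rpow htpos.le hGs.le] at hfin
  have hpow : (A x0).det ^ (-(p / (2 * (n : ℝ)))) = t ^ a * t⁻¹ := by
    rw [← htD, ← Real.rpow_natCast, ← Real.rpow_mul htpos.le, ← Real.rpow_neg_one t,
      ← Real.rpow_add htpos]
    congr 1
    have : a = (n - p) / n := by rw [← han]; field_simp
    rw [this]; push_cast; field_simp; ring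
  rw [hpow]
  refine le_of_mul_le_mul_left ?_ htpos
  calc t * (t ^ a * t⁻¹ * G s ^ a) = t ^ a * G s ^ a := by field_simp
    _ ≤ _ := hfin
    _ = _ := by ring

/-- Any constant `C₁` valid in the Sobolev inequality with lower-order
term satisfies `C₁ ≥ m_A^{-p/(2n)} · M_G^{p/p*} · S`. -/
theorem lower_bound_for_C1 {n d : ℕ} (hd : 0 < d) (p : ℝ) (hp1 : 1 < p) (hpn : p < n)
    (Ω : Set (EuclideanSpace ℝ (Fin n))) (hΩo : IsOpen Ω)
    (hΩb : Bornology.IsBounded Ω) (hΩne : Ω.Nonempty)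
    (A : EuclideanSpace ℝ (Fin n) → Matrix (Fin n) (Fin n) ℝ)
    (hAc : ContinuousOn A (closure Ω))
    (hAsymm : ∀ x ∈ closure Ω, (A x).IsSymm)
    (τ : ℝ) (hτ : 0 < τ)
    (hApos : ∀ x ∈ closure Ω, ∀ ξ : EuclideanSpace ℝ (Fin n),
      τ * ‖ξ‖ ^ 2 ≤ quadForm (A x) ξ)
    (G : EuclideanSpace ℝ (Fin d) → ℝ) (hGc : Continuous G)
    (hGhom : ∀ ϱ : ℝ, 0 < ϱ → ∀ s : EuclideanSpace ℝ (Fin d),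
      G (ϱ • s) = ϱ ^ ((n : ℝ) * p / ((n : ℝ) - p)) * G s)
    (hGpos : ∀ s : EuclideanSpace ℝ (Fin d), s ≠ 0 → 0 < G s)
    (C₁ C₂ : ℝ) (hC₁ : 0 < C₁) (hC₂ : 0 < C₂)
    (hineq : ∀ u : EuclideanSpace ℝ (Fin n) → EuclideanSpace ℝ (Fin d), SmoothCpt Ω u →
      (∫ x in Ω, G (u x)) ^ (p / ((n : ℝ) * p / ((n : ℝ) - p)))
        ≤ C₁ * WAnorm p Ω A u + C₂ * ∑ j, ∫ x in Ω, |u x j| ^ p) :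
    (sInf ((fun x => (A x).det) '' closure Ω)) ^ (-(p / (2 * (n : ℝ))))
      * (sSup (G '' {s : EuclideanSpace ℝ (Fin d) | (∑ i, |s i| ^ p) = 1}))
          ^ (p / ((n : ℝ) * p / ((n : ℝ) - p)))
      * classicalSobolev n p ≤ C₁ := by
  have hn0 : (0 : ℝ) < n := by linarith
  have hnp : (0 : ℝ) < n - p := by linarith
  have hp0 : 0 < p := by linarith
  set q := (n : ℝ) * p / ((n : ℝ) - p) with hqdef
  have hq : 0 < q := by positivity
  set a := p / q with hadef
  have ha : 0 < a := by positivity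
  have han : n * a = n - p := by
    rw [hadef, hqdef]; field_simp
  -- positive definiteness
  have hPD : ∀ x ∈ closure Ω, (A x).PosDef := by
    intro x hx
    refine Matrix.PosDef.of_dotProduct_mulVec_pos ?_ ?_
    · rw [Matrix.IsHermitian, Matrix.conjTranspose_eq_transpose_of_trivial]
      exact hAsymm x hx
    · intro y hy
      have h := hApos x hx (WithLp.toLp 2 y)
      rw [quadForm_eq_dot] at h
      have hne : WithLp.toLp 2 y ≠ 0 := by
        intro h0; apply hy; simpa using h0
      have : 0 < τ * ‖WithLp.toLp 2 y‖ ^ 2 := by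
        have := norm_pos_iff.mpr hne
        positivity
      simpa using this.trans_le h
  have hdetpos : ∀ x ∈ closure Ω, 0 < (A x).det := fun x hx => (hPD x hx).det_pos
  -- the maximum of G
  obtain ⟨s, hs, hsM⟩ : ∃ s : EuclideanSpace ℝ (Fin d), (∑ i, |s i| ^ p) = 1 ∧
      sSup (G '' {s : EuclideanSpace ℝ (Fin d) | (∑ i, |s i| ^ p) = 1}) = G s := by
    have hcpt : IsCompact {s : EuclideanSpace ℝ (Fin d) | (∑ i, |s i| ^ p) = 1} := by
      refine Metric.isCompact_of_isClosed_isBounded ?_ ?_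
      · refine isClosed_eq ?_ continuous_const
        refine continuous_finsetSum _ fun i _ => ?_
        have : Continuous fun s : EuclideanSpace ℝ (Fin d) => s i := by fun_prop
        exact this.abs.rpow_const fun _ => Or.inr hp0.le
      · refine (Metric.isBounded_closedBall (x := 0) (r := √d)).subset fun s hs => ?_
        rw [mem_closedBall_zero_iff]
        apply Real.le_sqrt_of_sq_le
        rw [EuclideanSpace.norm_sq_eq]
        have h1 : ∀ i ∈ Finset.univ, ‖s i‖ ^ 2 ≤ (1 : ℝ) := by
          intro i _
          have h2 : |s i| ^ p ≤ 1 := by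
            rw [← show (∑ i, |s i| ^ p) = 1 from hs]
            exact Finset.single_le_sum (f := fun i => |s i| ^ p)
              (fun i _ => by positivity) (Finset.mem_univ i)
          have h3 : |s i| ≤ 1 := by
            by_contra hc
            push Not at hc
            exact absurd h2 (not_le.mpr (Real.one_lt_rpow hc hp0))
          rw [Real.norm_eq_abs]
          exact pow_le_one₀ (abs_nonneg _) h3
        refine (Finset.sum_le_sum h1).trans ?_
        simp
    have hne : {s : EuclideanSpace ℝ (Fin d) | (∑ i, |s i| ^ p) = 1}.Nonempty := by
      refine ⟨EuclideanSpace.single ⟨0, hd⟩ 1, ?_⟩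
      rw [Set.mem_setOf_eq, Finset.sum_eq_single ⟨0, hd⟩]
      · simp
      · intro b _ hb
        simp [hb, hp0.ne']
      · simp
    obtain ⟨s, hs, h, -⟩ := hcpt.exists_sSup_image_eq_and_ge hne hGc.continuousOn
    exact ⟨s, hs, h⟩
  have hs0 : s ≠ 0 := by
    rintro rfl
    simp [hp0.ne'] at hs
  have hGs : 0 < G s := hGpos s hs0
  -- the minimum of det
  obtain ⟨x1, hx1, hx1m⟩ : ∃ x1 ∈ closure Ω,
      sInf ((fun x => (A x).det) '' closure Ω) = (A x1).det := by
    obtain ⟨x, hx, h, -⟩ := (hΩb.isCompact_closure).exists_sInf_image_eq_and_le hΩne.closure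
      (f := fun x => (A x).det) (Continuous.comp_continuousOn (g := fun M => Matrix.det M) (continuous_id.matrix_det) hAc)
    exact ⟨x, hx, h⟩
  rw [hsM, hx1m]
  unfold classicalSobolev
  rw [← hqdef]
  set R := {r : ℝ | ∃ u : EuclideanSpace ℝ (Fin n) → ℝ,
    ContDiff ℝ (⊤ : ℕ∞) u ∧ HasCompactSupport u ∧ (∫ x, |u x| ^ q) = 1 ∧
    r = ∫ x, ‖gradient u x‖ ^ p} with hR
  have hR0 : 0 ≤ sInf R := by
    apply Real.sInf_nonneg
    rintro r ⟨u, -, -, -, rfl⟩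
    exact integral_nonneg fun x => by positivity
  rcases hR0.eq_or_lt with h0 | h0
  · rw [← h0, inv_zero, mul_zero]; exact hC₁.le
  have hRne : R.Nonempty := by
    by_contra h
    rw [Set.not_nonempty_iff_eq_empty] at h
    rw [h, Real.sInf_empty] at h0
    exact lt_irrefl _ h0
  rw [← div_eq_mul_inv, div_le_iff₀ h0, mul_comm C₁, ← div_le_iff₀ hC₁]
  refine le_csInf hRne ?_
  rintro r ⟨u, hu, huc, hu1, rfl⟩
  rw [div_le_iff₀ hC₁, mul_comm _ C₁]
  have hall : ∀ x ∈ Ω, (A x).det ^ (-(p / (2 * (n : ℝ)))) * G s ^ a ≤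
      C₁ * ∫ x, ‖gradient u x‖ ^ p := by
    intro x hx
    exact step4 p q a hp0 hq ha hn0 han Ω hΩo A (hAc.mono subset_closure) τ hτ
      (fun x hx => hApos x (subset_closure hx)) G hGhom C₁ C₂ hC₁ hC₂ hineq s hs hGs x hx
      (hPD x (subset_closure hx)) u hu huc hu1
  have hc : ContinuousOn (fun x => (A x).det ^ (-(p / (2 * (n : ℝ)))) * G s ^ a) (closure Ω) := by
    refine ContinuousOn.mul ?_ continuousOn_const
    refine ContinuousOn.rpow_const (Continuous.comp_continuousOn (g := fun M => Matrix.det M) (continuous_id.matrix_det) hAc) ?_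
    intro x hx
    exact Or.inl (hdetpos x hx).ne'
  exact le_on_closure hall hc continuousOn_const hx1
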